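/- arXiv:1610.02190 — 2 statements merged into one kernel-verified Lean document; each statement's English description precedes it below -/
import Mathlib

section
/- For fixed real a < b, if (μ_t) is non-decreasing in the WDS order, so is the censored family μ^{a,b}_t(dy) = 1_{(−∞,a)∪(b,∞)}(y) μ_t(dy) + α_t δ_a(dy) + β_t δ_b(dy), where α_t = (1/(b−a))∫_{[a,b]}(b−y)dμ_t(y) and β_t = (1/(b−a))∫_{[a,b]}(y−a)dμ_t(y). -/
open MeasureTheory Set Filter

noncomputable def meanM (μ : Measure ℝ) : ℝ := ∫ y, y ∂μ

noncomputable def rSupE (μ : Measure ℝ) : EReal :=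
  sInf ((fun z : ℝ => (z : EReal)) '' {z : ℝ | μ (Ici z) = 0})

noncomputable def psiWds (μ : Measure ℝ) (x : ℝ) : EReal :=
  if (x : EReal) < rSupE μ then
    ((((∫ y in Ici x, y ∂μ) - meanM μ) / (μ (Ici x)).toReal : ℝ) : EReal)
  else ⊤

noncomputable def Kfun (μ : Measure ℝ) (x : ℝ) : ℝ :=
  (∫ y in Ici x, (y - x) ∂μ) - meanM μ

noncomputable def censor (a b : ℝ) (μ : Measure ℝ) : Measure ℝ :=
  μ.restrict (Iio a ∪ Ioi b)
    + ENNReal.ofReal ((b - a)⁻¹ * ∫ y in Icc a b, (b - y) ∂μ) • Measure.dirac a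
    + ENNReal.ofReal ((b - a)⁻¹ * ∫ y in Icc a b, (y - a) ∂μ) • Measure.dirac b

namespace WdsAux

/-- tail mass -/
noncomputable def G (μ : Measure ℝ) (x : ℝ) : ℝ := (μ (Ici x)).toReal

noncomputable def K (μ : Measure ℝ) (x : ℝ) : ℝ := (∫ y, max (y - x) 0 ∂μ) - meanM μ

lemma G_eq (μ : Measure ℝ) (x : ℝ) : G μ x = ∫ y, (Ici x).indicator (fun _ => (1 : ℝ)) y ∂μ := by
  rw [integral_indicator measurableSet_Ici]
  simp [G, Measure.real]

lemma int_ind (μ : Measure ℝ) [IsFiniteMeasure μ] (x : ℝ) :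
    Integrable (fun y => (Ici x).indicator (fun _ => (1 : ℝ)) y) μ :=
  (integrable_const (1 : ℝ)).indicator measurableSet_Ici

lemma int_max (μ : Measure ℝ) [IsFiniteMeasure μ] (h : Integrable (fun y : ℝ => y) μ) (x : ℝ) :
    Integrable (fun y => max (y - x) 0) μ :=
  (h.sub (integrable_const x)).sup (integrable_const 0)

lemma num_eq (μ : Measure ℝ) [IsFiniteMeasure μ] (h : Integrable (fun y : ℝ => y) μ) (x : ℝ) :
    (∫ y in Ici x, y ∂μ) - meanM μ = K μ x + x * G μ x := by
  rw [K, G_eq, ← integral_indicator measurableSet_Ici, ← integral_const_mul]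
  have : ∫ y, (Ici x).indicator (fun y => y) y ∂μ
      = (∫ y, max (y - x) 0 ∂μ) + ∫ y, x * (Ici x).indicator (fun _ => (1 : ℝ)) y ∂μ := by
    rw [← integral_add (int_max μ h x) ((int_ind μ x).const_mul x)]
    congr 1
    ext y
    by_cases hy : x ≤ y
    · rw [max_eq_left (by linarith)]; simp [hy]
    · rw [max_eq_right (by linarith)]; simp [hy]
  rw [this]; ring

lemma G_nonneg (μ : Measure ℝ) (x : ℝ) : 0 ≤ G μ x := ENNReal.toReal_nonneg

lemma G_anti (μ : Measure ℝ) [IsFiniteMeasure μ] {x y : ℝ} (h : x ≤ y) : G μ y ≤ G μ x :=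
  ENNReal.toReal_mono (measure_ne_top _ _) (measure_mono (Ici_subset_Ici.2 h))

lemma K_pos (μ : Measure ℝ) (h : meanM μ < 0) (x : ℝ) : 0 < K μ x := by
  have : 0 ≤ ∫ y, max (y - x) 0 ∂μ := integral_nonneg fun y => le_max_right _ _
  unfold K; linarith

lemma lt_r_iff (μ : Measure ℝ) [IsFiniteMeasure μ] (x : ℝ) :
    (x : EReal) < rSupE μ ↔ ∃ z, x < z ∧ 0 < G μ z := by
  constructor
  · intro h
    obtain ⟨z, h1, h2⟩ := EReal.lt_iff_exists_real_btwn.1 h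
    refine ⟨z, EReal.coe_lt_coe_iff.1 h1, ?_⟩
    refine ENNReal.toReal_pos (fun h0 => ?_) (measure_ne_top _ _)
    have h3 : rSupE μ ≤ (z : EReal) := sInf_le ⟨z, h0, rfl⟩
    exact absurd h3 (not_le.2 h2)
  · rintro ⟨z, h1, h2⟩
    refine lt_of_lt_of_le (EReal.coe_lt_coe_iff.2 h1) ?_
    refine le_sInf ?_
    rintro _ ⟨w, hw, rfl⟩
    refine EReal.coe_le_coe_iff.2 ?_
    by_contra hlt
    have := G_anti μ (not_le.1 hlt).le
    have h0 : G μ w = 0 := by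
      have hw' : μ (Ici w) = 0 := hw
      simp [G, hw']
    linarith

lemma psi_of_lt (μ : Measure ℝ) [IsFiniteMeasure μ] (h : Integrable (fun y : ℝ => y) μ) (x : ℝ)
    (hx : (x : EReal) < rSupE μ) :
    psiWds μ x = ((x + K μ x / G μ x : ℝ) : EReal) ∧ 0 < G μ x := by
  have hG : 0 < G μ x := by
    obtain ⟨z, h1, h2⟩ := (lt_r_iff μ x).1 hx
    exact h2.trans_le (G_anti μ h1.le)
  refine ⟨?_, hG⟩
  rw [psiWds, if_pos hx, num_eq μ h]
  congr 1
  change (K μ x + x * G μ x) / G μ x = _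
  field_simp
  ring

lemma psi_le_of (μ ν : Measure ℝ) [IsFiniteMeasure μ] [IsFiniteMeasure ν]
    (hμ : Integrable (fun y : ℝ => y) μ) (hν : Integrable (fun y : ℝ => y) ν)
    (mμ : meanM μ < 0) (mν : meanM ν < 0)
    (P : ∀ x, G ν x * K μ x ≤ G μ x * K ν x) (x : ℝ) : psiWds μ x ≤ psiWds ν x := by
  by_cases hx : (x : EReal) < rSupE ν
  · have hx' : (x : EReal) < rSupE μ := by
      obtain ⟨z, h1, h2⟩ := (lt_r_iff ν x).1 hx
      refine (lt_r_iff μ x).2 ⟨z, h1, ?_⟩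
      have h3 := mul_pos h2 (K_pos μ mμ z)
      exact pos_of_mul_pos_left (h3.trans_le (P z)) (K_pos ν mν z).le
    obtain ⟨e1, g1⟩ := psi_of_lt μ hμ x hx'
    obtain ⟨e2, g2⟩ := psi_of_lt ν hν x hx
    rw [e1, e2, EReal.coe_le_coe_iff]
    have : K μ x / G μ x ≤ K ν x / G ν x := by
      rw [div_le_div_iff₀ g1 g2]
      have := P x
      linarith
    linarith
  · rw [psiWds, psiWds, if_neg hx]
    exact le_top

lemma G_left (μ : Measure ℝ) [IsFiniteMeasure μ] (x : ℝ) :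
    Tendsto (G μ) (nhdsWithin x (Iio x)) (nhds (G μ x)) := by
  have : G μ = fun x => ∫ y, (Ici x).indicator (fun _ => (1 : ℝ)) y ∂μ := funext (G_eq μ)
  rw [this]
  refine tendsto_integral_filter_of_dominated_convergence (fun _ => (1 : ℝ)) ?_ ?_
    (integrable_const _) ?_
  · exact Eventually.of_forall fun y => (int_ind μ y).aestronglyMeasurable
  · refine Eventually.of_forall fun y => Eventually.of_forall fun z => ?_
    by_cases hz : y ≤ z <;> simp [hz]
  · refine Eventually.of_forall fun z => ?_
    refine Tendsto.congr' ?_ tendsto_const_nhds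
    by_cases hz : x ≤ z
    · filter_upwards [self_mem_nhdsWithin] with y hy
      have : y ≤ z := (le_of_lt hy).trans hz
      simp [hz, this]
    · have h1 : Ioi z ∈ nhdsWithin x (Iio x) := mem_nhdsWithin_of_mem_nhds (Ioi_mem_nhds (not_le.1 hz))
      filter_upwards [h1] with y hy
      have : ¬ y ≤ z := not_le.2 hy
      simp [hz, this]

lemma K_sub (μ : Measure ℝ) [IsFiniteMeasure μ] (h : Integrable (fun y : ℝ => y) μ) {x y : ℝ}
    (hyx : y ≤ x) : (x - y) * G μ x ≤ K μ y - K μ x ∧ K μ y - K μ x ≤ (x - y) * G μ y := by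
  have e : K μ y - K μ x = ∫ z, (max (z - y) 0 - max (z - x) 0) ∂μ := by
    rw [integral_sub (int_max μ h y) (int_max μ h x)]; unfold K; ring
  have hi : Integrable (fun z => max (z - y) 0 - max (z - x) 0) μ :=
    (int_max μ h y).sub (int_max μ h x)
  rw [e, G_eq, G_eq, ← integral_const_mul, ← integral_const_mul]
  constructor
  · refine integral_mono ((int_ind μ x).const_mul _) hi fun z => ?_
    by_cases hz : x ≤ z
    · have h1 : max (z - y) 0 = z - y := max_eq_left (by linarith)
      have h2 : max (z - x) 0 = z - x := max_eq_left (by linarith)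
      simp only [h1, h2]; simp [hz]
    · have h2 : max (z - x) 0 = 0 := max_eq_right (by linarith)
      simp only [h2]; simp [hz]
  · refine integral_mono hi ((int_ind μ y).const_mul _) fun z => ?_
    by_cases hz : y ≤ z
    · have h1 : max (z - y) 0 = z - y := max_eq_left (by linarith)
      have h2 : z - x ≤ max (z - x) 0 := le_max_left _ _
      simp only [h1]; simp [hz]; linarith
    · have h1 : max (z - y) 0 = 0 := max_eq_right (by linarith)
      have h2 : max (z - x) 0 = 0 := max_eq_right (by linarith)
      simp only [h1, h2]; simp [hz]

lemma K_cont (μ : Measure ℝ) [IsFiniteMeasure μ] (h : Integrable (fun y : ℝ => y) μ) :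
    Continuous (K μ) := by
  unfold K
  refine Continuous.sub ?_ continuous_const
  refine continuous_iff_continuousAt.2 fun x => ?_
  refine tendsto_integral_filter_of_dominated_convergence (fun z => ‖z‖ + (|x| + 1)) ?_ ?_
    (h.norm.add (integrable_const _)) ?_
  · exact Eventually.of_forall fun y => (int_max μ h y).aestronglyMeasurable
  · filter_upwards [Metric.ball_mem_nhds x one_pos] with y hy
    refine Eventually.of_forall fun z => ?_
    rw [Metric.mem_ball, Real.dist_eq, abs_lt] at hy
    rw [Real.norm_eq_abs, Real.norm_eq_abs, abs_of_nonneg (le_max_right _ _)]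
    have := le_abs_self z
    have := neg_abs_le x
    have := abs_nonneg z
    have := abs_nonneg x
    exact max_le (by linarith) (by linarith)
  · refine Eventually.of_forall fun z => ?_
    have : Continuous fun y : ℝ => max (z - y) 0 := by fun_prop
    exact this.tendsto x

lemma K_deriv (μ : Measure ℝ) [IsFiniteMeasure μ] (h : Integrable (fun y : ℝ => y) μ) (u : ℝ) :
    HasDerivWithinAt (fun v => K μ (-v)) (G μ (-u)) (Ici u) u := by
  rw [hasDerivWithinAt_iff_tendsto_slope, Ici_sdiff_left]
  have hneg : Tendsto (fun v : ℝ => -v) (nhdsWithin u (Ioi u)) (nhdsWithin (-u) (Iio (-u))) := by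
    refine tendsto_nhdsWithin_of_tendsto_nhds_of_eventually_within _ ?_ ?_
    · exact (continuous_neg.tendsto u).mono_left nhdsWithin_le_nhds
    · filter_upwards [self_mem_nhdsWithin] with v hv
      exact neg_lt_neg (mem_Ioi.1 hv)
  refine tendsto_of_tendsto_of_tendsto_of_le_of_le' tendsto_const_nhds ((G_left μ (-u)).comp hneg) ?_ ?_
  · filter_upwards [self_mem_nhdsWithin] with v hv
    have hv : u < v := hv
    rw [slope_def_field, le_div_iff₀ (by linarith)]
    have := (K_sub μ h (x := -u) (y := -v) (by linarith)).1
    linarith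
  · filter_upwards [self_mem_nhdsWithin] with v hv
    have hv : u < v := hv
    rw [slope_def_field, div_le_iff₀ (by linarith)]
    have := (K_sub μ h (x := -u) (y := -v) (by linarith)).2
    simp only [Function.comp]
    linarith

lemma P_of_psi (μ ν : Measure ℝ) [IsFiniteMeasure μ] [IsFiniteMeasure ν]
    (hμ : Integrable (fun y : ℝ => y) μ) (hν : Integrable (fun y : ℝ => y) ν)
    (mν : meanM ν < 0)
    (H : ∀ x, psiWds μ x ≤ psiWds ν x) (x : ℝ) : G ν x * K μ x ≤ G μ x * K ν x := by
  have main : ∀ y : ℝ, (y : EReal) < rSupE ν → G ν y * K μ y ≤ G μ y * K ν y := by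
    intro y hy
    obtain ⟨e2, g2⟩ := psi_of_lt ν hν y hy
    have hy' : (y : EReal) < rSupE μ := by
      by_contra hc
      have h1 := H y
      rw [e2, psiWds, if_neg hc] at h1
      exact absurd (top_le_iff.1 h1) (EReal.coe_ne_top _)
    obtain ⟨e1, g1⟩ := psi_of_lt μ hμ y hy'
    have h1 := H y
    rw [e1, e2, EReal.coe_le_coe_iff] at h1
    have : K μ y / G μ y ≤ K ν y / G ν y := by linarith
    rw [div_le_div_iff₀ g1 g2] at this
    linarith
  by_cases h0 : 0 < G ν x
  · have ev : ∀ᶠ y in nhdsWithin x (Iio x), G ν y * K μ y ≤ G μ y * K ν y := by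
      filter_upwards [self_mem_nhdsWithin] with y hy
      exact main y ((lt_r_iff ν y).2 ⟨x, hy, h0⟩)
    have c1 := ((K_cont μ hμ).tendsto x).mono_left (nhdsWithin_le_nhds (s := Iio x))
    have c2 := ((K_cont ν hν).tendsto x).mono_left (nhdsWithin_le_nhds (s := Iio x))
    exact le_of_tendsto_of_tendsto ((G_left ν x).mul c1) ((G_left μ x).mul c2) ev
  · have : G ν x = 0 := le_antisymm (not_lt.1 h0) (G_nonneg _ _)
    rw [this, zero_mul]
    exact mul_nonneg (G_nonneg _ _) (K_pos ν mν x).le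

lemma tp2 (μ ν : Measure ℝ) [IsFiniteMeasure μ] [IsFiniteMeasure ν]
    (hμ : Integrable (fun y : ℝ => y) μ) (hν : Integrable (fun y : ℝ => y) ν)
    (mν : meanM ν < 0)
    (P : ∀ x, G ν x * K μ x ≤ G μ x * K ν x) {a b : ℝ} (hab : a ≤ b) :
    K ν a * K μ b ≤ K μ a * K ν b := by
  have hc : Continuous (fun v => K μ (-v) / K ν (-v)) :=
    ((K_cont μ hμ).comp continuous_neg).div ((K_cont ν hν).comp continuous_neg)
      fun v => (K_pos ν mν _).ne'
  have := image_le_of_deriv_right_le_deriv_boundary (a := -b) (b := -a)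
    (f := fun _ => K μ b / K ν b) (f' := fun _ => 0)
    (B := fun v => K μ (-v) / K ν (-v))
    (B' := fun v => (G μ (-v) * K ν (-v) - K μ (-v) * G ν (-v)) / (K ν (-v)) ^ 2)
    continuousOn_const (fun _ _ => hasDerivWithinAt_const _ _ _) (by simp) hc.continuousOn
    (fun v _ => (K_deriv μ hμ v).div (K_deriv ν hν v) (K_pos ν mν _).ne')
    (fun v _ => div_nonneg (by have := P (-v); linarith) (sq_nonneg _))
    (right_mem_Icc.2 (by linarith))
  simp only [neg_neg] at this
  rw [div_le_div_iff₀ (K_pos ν mν _) (K_pos ν mν _)] at this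
  linarith

/-- linear interpolation of `f` on `[a,b]` -/
noncomputable def interp (a b : ℝ) (f : ℝ → ℝ) (y : ℝ) : ℝ :=
  (Iio a ∪ Ioi b).indicator f y +
    (Icc a b).indicator (fun y => (b - a)⁻¹ * (f a * (b - y) + f b * (y - a))) y

lemma interp_eq {a b : ℝ} (f g : ℝ → ℝ)
    (h1 : ∀ y, y < a ∨ b < y → f y = g y)
    (h2 : ∀ y, a ≤ y → y ≤ b → (b - a)⁻¹ * (f a * (b - y) + f b * (y - a)) = g y) :
    interp a b f = g := by
  ext y
  unfold interp
  by_cases hy : y < a ∨ b < y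
  · have h3 : y ∈ Iio a ∪ Ioi b := hy
    have h4 : y ∉ Icc a b := by
      rintro ⟨h5, h6⟩
      rcases hy with hy | hy <;> linarith
    rw [indicator_of_mem h3, indicator_of_notMem h4, add_zero, h1 y hy]
  · have h3 : y ∉ Iio a ∪ Ioi b := hy
    push Not at hy
    have h4 : y ∈ Icc a b := hy
    rw [indicator_of_mem h4, indicator_of_notMem h3, zero_add, h2 y hy.1 hy.2]

instance (a b : ℝ) (μ : Measure ℝ) [IsFiniteMeasure μ] : IsFiniteMeasure (censor a b μ) := by
  unfold censor
  have : ∀ (c x : ℝ), IsFiniteMeasure (ENNReal.ofReal c • Measure.dirac x) := fun c x =>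
    ⟨by simp⟩
  have := this ((b - a)⁻¹ * ∫ y in Icc a b, (b - y) ∂μ) a
  have := ‹∀ (c x : ℝ), IsFiniteMeasure (ENNReal.ofReal c • Measure.dirac x)›
    ((b - a)⁻¹ * ∫ y in Icc a b, (y - a) ∂μ) b
  infer_instance

lemma int_dirac (f : ℝ → ℝ) (c x : ℝ) : Integrable f (ENNReal.ofReal c • Measure.dirac x) :=
  (integrable_dirac (by simp)).smul_measure ENNReal.ofReal_ne_top

lemma int_censor (a b : ℝ) (μ : Measure ℝ) {f : ℝ → ℝ} (hf : Integrable f μ) :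
    Integrable f (censor a b μ) :=
  (hf.restrict.add_measure (int_dirac _ _ _)).add_measure (int_dirac _ _ _)

lemma integral_censor {a b : ℝ} (hab : a < b) (μ : Measure ℝ) [IsFiniteMeasure μ]
    (h : Integrable (fun y : ℝ => y) μ) {f : ℝ → ℝ} (hf : Integrable f μ) :
    ∫ y, f y ∂(censor a b μ) = ∫ y, interp a b f y ∂μ := by
  have hba : 0 ≤ (b - a)⁻¹ := inv_nonneg.2 (by linarith)
  have n1 : 0 ≤ ∫ y in Icc a b, (b - y) ∂μ :=
    setIntegral_nonneg measurableSet_Icc fun y hy => sub_nonneg.2 hy.2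
  have n2 : 0 ≤ ∫ y in Icc a b, (y - a) ∂μ :=
    setIntegral_nonneg measurableSet_Icc fun y hy => sub_nonneg.2 hy.1
  have i1 : Integrable (fun y : ℝ => b - y) μ := (integrable_const b).sub h
  have i2 : Integrable (fun y : ℝ => y - a) μ := h.sub (integrable_const a)
  have i3 : Integrable (fun y => (b - a)⁻¹ * (f a * (b - y) + f b * (y - a))) μ :=
    ((i1.const_mul _).add (i2.const_mul _)).const_mul _
  have hm : MeasurableSet (Iio a ∪ Ioi b) := measurableSet_Iio.union measurableSet_Ioi
  unfold censor interp
  rw [integral_add_measure (hf.restrict.add_measure (int_dirac _ _ _)) (int_dirac _ _ _),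
    integral_add_measure hf.restrict (int_dirac _ _ _), integral_smul_measure,
    integral_smul_measure, integral_dirac, integral_dirac,
    integral_add (hf.indicator hm) (i3.indicator measurableSet_Icc),
    integral_indicator hm, integral_indicator measurableSet_Icc,
    integral_const_mul, integral_add (i1.const_mul _).restrict (i2.const_mul _).restrict,
    integral_const_mul, integral_const_mul,
    ENNReal.toReal_ofReal (mul_nonneg hba n1), ENNReal.toReal_ofReal (mul_nonneg hba n2)]
  simp only [smul_eq_mul]
  ring

lemma mean_censor {a b : ℝ} (hab : a < b) (μ : Measure ℝ) [IsFiniteMeasure μ]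
    (h : Integrable (fun y : ℝ => y) μ) : meanM (censor a b μ) = meanM μ := by
  have hb : b - a ≠ 0 := by linarith
  rw [meanM, integral_censor hab μ h h, meanM, interp_eq (fun y => y) (fun y => y) (fun _ _ => rfl)]
  intro y _ _
  field_simp; ring

lemma G_censor_out {a b : ℝ} (hab : a < b) (μ : Measure ℝ) [IsFiniteMeasure μ]
    (h : Integrable (fun y : ℝ => y) μ) {x : ℝ} (hx : x ≤ a ∨ b < x) :
    G (censor a b μ) x = G μ x := by
  have hb : b - a ≠ 0 := by linarith
  rw [G_eq, G_eq, integral_censor hab μ h (int_ind μ x),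
    interp_eq _ (fun y => (Ici x).indicator (fun _ => (1 : ℝ)) y) (fun _ _ => rfl)]
  intro y h1 h2
  rcases hx with hx | hx
  · have e1 : x ≤ b := by linarith
    have e2 : x ≤ y := by linarith
    simp [hx, e1, e2]
    field_simp
  · have e0 : ¬ x ≤ a := by linarith
    have e1 : ¬ x ≤ b := by linarith
    have e2 : ¬ x ≤ y := by linarith
    simp [e0, e1, e2]

lemma K_censor_out {a b : ℝ} (hab : a < b) (μ : Measure ℝ) [IsFiniteMeasure μ]
    (h : Integrable (fun y : ℝ => y) μ) {x : ℝ} (hx : x ≤ a ∨ b < x) :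
    K (censor a b μ) x = K μ x := by
  have hb : b - a ≠ 0 := by linarith
  rw [K, K, mean_censor hab μ h, integral_censor hab μ h (int_max μ h x),
    interp_eq _ (fun y => max (y - x) 0) (fun _ _ => rfl)]
  intro y h1 h2
  rcases hx with hx | hx
  · have e0 : max (a - x) 0 = a - x := max_eq_left (by linarith)
    have e1 : max (b - x) 0 = b - x := max_eq_left (by linarith)
    have e2 : max (y - x) 0 = y - x := max_eq_left (by linarith)
    rw [e0, e1, e2]
    field_simp; ring
  · have e0 : max (a - x) 0 = 0 := max_eq_right (by linarith)
    have e1 : max (b - x) 0 = 0 := max_eq_right (by linarith)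
    have e2 : max (y - x) 0 = 0 := max_eq_right (by linarith)
    rw [e0, e1, e2]
    ring

lemma G_censor_in {a b : ℝ} (hab : a < b) (μ : Measure ℝ) [IsFiniteMeasure μ]
    (h : Integrable (fun y : ℝ => y) μ) {x : ℝ} (hx : a < x) (hx' : x ≤ b) :
    G (censor a b μ) x = (b - a)⁻¹ * (K μ a - K μ b) := by
  have hb : b - a ≠ 0 := by linarith
  have e : K μ a - K μ b = ∫ z, (max (z - a) 0 - max (z - b) 0) ∂μ := by
    rw [integral_sub (int_max μ h a) (int_max μ h b)]; unfold K; ring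
  rw [e, ← integral_const_mul, G_eq, integral_censor hab μ h (int_ind μ x),
    interp_eq _ (fun y => (b - a)⁻¹ * (max (y - a) 0 - max (y - b) 0))]
  · rintro y (hy | hy)
    · have e0 : max (y - a) 0 = 0 := max_eq_right (by linarith)
      have e1 : max (y - b) 0 = 0 := max_eq_right (by linarith)
      have e2 : ¬ x ≤ y := by linarith
      simp only [e0, e1]
      simp [e2]
    · have e0 : max (y - a) 0 = y - a := max_eq_left (by linarith)
      have e1 : max (y - b) 0 = y - b := max_eq_left (by linarith)
      have e2 : x ≤ y := by linarith
      simp only [e0, e1]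
      simp [e2]
      field_simp
  · intro y h1 h2
    have e0 : max (y - a) 0 = y - a := max_eq_left (by linarith)
    have e1 : max (y - b) 0 = 0 := max_eq_right (by linarith)
    have e2 : ¬ x ≤ a := by linarith
    simp only [e0, e1]
    simp [e2, hx']

lemma K_censor_in {a b : ℝ} (hab : a < b) (μ : Measure ℝ) [IsFiniteMeasure μ]
    (h : Integrable (fun y : ℝ => y) μ) {x : ℝ} (hx : a < x) (hx' : x ≤ b) :
    K (censor a b μ) x = K μ b + (b - x) * ((b - a)⁻¹ * (K μ a - K μ b)) := by
  have hb : b - a ≠ 0 := by linarith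
  have e : K μ a - K μ b = ∫ z, (max (z - a) 0 - max (z - b) 0) ∂μ := by
    rw [integral_sub (int_max μ h a) (int_max μ h b)]; unfold K; ring
  have hi : Integrable (fun z => max (z - a) 0 - max (z - b) 0) μ :=
    (int_max μ h a).sub (int_max μ h b)
  have e3 : K (censor a b μ) x = ∫ y, (max (y - b) 0 +
      (b - x) * ((b - a)⁻¹ * (max (y - a) 0 - max (y - b) 0))) ∂μ - meanM μ := by
    rw [K, mean_censor hab μ h, integral_censor hab μ h (int_max μ h x),
      interp_eq _ (fun y => max (y - b) 0 +
        (b - x) * ((b - a)⁻¹ * (max (y - a) 0 - max (y - b) 0)))]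
    · rintro y (hy | hy)
      · have e0 : max (y - a) 0 = 0 := max_eq_right (by linarith)
        have e1 : max (y - b) 0 = 0 := max_eq_right (by linarith)
        have e2 : max (y - x) 0 = 0 := max_eq_right (by linarith)
        rw [e0, e1, e2]; ring
      · have e0 : max (y - a) 0 = y - a := max_eq_left (by linarith)
        have e1 : max (y - b) 0 = y - b := max_eq_left (by linarith)
        have e2 : max (y - x) 0 = y - x := max_eq_left (by linarith)
        rw [e0, e1, e2]
        field_simp; ring
    · intro y h1 h2
      have e0 : max (y - a) 0 = y - a := max_eq_left (by linarith)
      have e1 : max (y - b) 0 = 0 := max_eq_right (by linarith)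
      have e2 : max (a - x) 0 = 0 := max_eq_right (by linarith)
      have e4 : max (b - x) 0 = b - x := max_eq_left (by linarith)
      rw [e0, e1, e2, e4]; ring
  rw [e3, e, integral_add (int_max μ h b) ((hi.const_mul _).const_mul _),
    integral_const_mul, integral_const_mul]
  unfold K; ring

end WdsAux

theorem stmt11 (a b : ℝ) (hab : a < b) (μ : ℝ → Measure ℝ)
    (hprob : ∀ t, 0 ≤ t → IsProbabilityMeasure (μ t))
    (hint : ∀ t, 0 ≤ t → Integrable (fun y : ℝ => y) (μ t))
    (hneg : ∀ t, 0 ≤ t → meanM (μ t) < 0)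
    (hwds : ∀ s t, 0 ≤ s → s ≤ t → ∀ x : ℝ, psiWds (μ s) x ≤ psiWds (μ t) x) :
    ∀ s t, 0 ≤ s → s ≤ t → ∀ x : ℝ,
      psiWds (censor a b (μ s)) x ≤ psiWds (censor a b (μ t)) x := by
  intro s t hs hst
  have ht : 0 ≤ t := hs.trans hst
  have := hprob s hs
  have := hprob t ht
  have is := hint s hs
  have it := hint t ht
  have P := WdsAux.P_of_psi (μ s) (μ t) is it (hneg t ht) (hwds s t hs hst)
  have T := WdsAux.tp2 (μ s) (μ t) is it (hneg t ht) P hab.le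
  refine WdsAux.psi_le_of _ _ (WdsAux.int_censor a b _ is) (WdsAux.int_censor a b _ it)
    (by rw [WdsAux.mean_censor hab _ is]; exact hneg s hs)
    (by rw [WdsAux.mean_censor hab _ it]; exact hneg t ht) ?_
  intro x
  by_cases hx : x ≤ a ∨ b < x
  · rw [WdsAux.G_censor_out hab _ is hx, WdsAux.G_censor_out hab _ it hx,
      WdsAux.K_censor_out hab _ is hx, WdsAux.K_censor_out hab _ it hx]
    exact P x
  · push Not at hx
    rw [WdsAux.G_censor_in hab _ is hx.1 hx.2, WdsAux.G_censor_in hab _ it hx.1 hx.2,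
      WdsAux.K_censor_in hab _ is hx.1 hx.2, WdsAux.K_censor_in hab _ it hx.1 hx.2]
    have hba : 0 ≤ (b - a)⁻¹ := inv_nonneg.2 (by linarith)
    have := mul_le_mul_of_nonneg_left T hba
    linarith
end

section
/- Let (X_t)_{t≥0} be integrable with negative means and WDS ordered, and Y an integrable centered random variable, independent of X, with log-concave density f_Y. Then (X_t + Y)_{t≥0} is WDS ordered. -/
open MeasureTheory Set Filter

/-- call function minus mean -/
noncomputable def KK (μ : Measure ℝ) (x : ℝ) : ℝ := (∫ u, max (u - x) 0 ∂μ) - ∫ u, u ∂μ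

theorem int_call (μ : Measure ℝ) [IsProbabilityMeasure μ] (h : Integrable (fun u : ℝ => u) μ)
    (x : ℝ) : Integrable (fun u : ℝ => max (u - x) 0) μ :=
  (h.sub (integrable_const x)).pos_part

theorem KK_pos (μ : Measure ℝ) (hm : (∫ u, u ∂μ) < 0) (x : ℝ) : 0 < KK μ x := by
  have : 0 ≤ ∫ u, max (u - x) 0 ∂μ := integral_nonneg fun u => le_max_right _ _
  unfold KK; linarith

theorem KK_diff_lower (μ : Measure ℝ) [IsProbabilityMeasure μ]
    (h : Integrable (fun u : ℝ => u) μ) {x y : ℝ} (hxy : x ≤ y) :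
    μ.real (Ici y) * (y - x) ≤ KK μ x - KK μ y := by
  have e : KK μ x - KK μ y = ∫ u, (max (u - x) 0 - max (u - y) 0) ∂μ := by
    rw [integral_sub (int_call μ h x) (int_call μ h y)]; unfold KK; ring
  have e2 : μ.real (Ici y) * (y - x) = ∫ u, (Ici y).indicator (fun _ => y - x) u ∂μ := by
    rw [integral_indicator_const _ measurableSet_Ici, smul_eq_mul]
  rw [e, e2]
  refine integral_mono ((integrable_const _).indicator measurableSet_Ici)
    ((int_call μ h x).sub (int_call μ h y)) fun u => ?_
  by_cases hu : u ∈ Ici y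
  · have := mem_Ici.1 hu
    simp only [indicator_of_mem hu]
    rw [max_eq_left (by linarith), max_eq_left (by linarith)]; linarith
  · simp only [indicator_of_notMem hu]
    have : max (u - y) 0 ≤ max (u - x) 0 := max_le_max (by linarith) le_rfl
    linarith

theorem KK_diff_upper (μ : Measure ℝ) [IsProbabilityMeasure μ]
    (h : Integrable (fun u : ℝ => u) μ) {x y : ℝ} (hxy : x ≤ y) :
    KK μ x - KK μ y ≤ μ.real (Ioi x) * (y - x) := by
  have e : KK μ x - KK μ y = ∫ u, (max (u - x) 0 - max (u - y) 0) ∂μ := by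
    rw [integral_sub (int_call μ h x) (int_call μ h y)]; unfold KK; ring
  have e2 : μ.real (Ioi x) * (y - x) = ∫ u, (Ioi x).indicator (fun _ => y - x) u ∂μ := by
    rw [integral_indicator_const _ measurableSet_Ioi, smul_eq_mul]
  rw [e, e2]
  refine integral_mono ((int_call μ h x).sub (int_call μ h y))
    ((integrable_const _).indicator measurableSet_Ioi) fun u => ?_
  by_cases hu : u ∈ Ioi x
  · have := mem_Ioi.1 hu
    simp only [indicator_of_mem hu]
    rw [max_eq_left (a := u - x) (by linarith)]
    have := le_max_left (u - y) 0
    linarith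
  · have : u ≤ x := not_lt.1 hu
    simp only [indicator_of_notMem hu]
    rw [max_eq_right (by linarith), max_eq_right (by linarith)]; linarith

theorem KK_cont (μ : Measure ℝ) [IsProbabilityMeasure μ]
    (h : Integrable (fun u : ℝ => u) μ) : Continuous (KK μ) := by
  have : LipschitzWith 1 (KK μ) := by
    refine LipschitzWith.of_le_add_mul 1 fun x y => ?_
    rw [Real.dist_eq]
    rcases le_total x y with hxy | hxy
    · have h1 := KK_diff_upper μ h hxy
      have h2 : μ.real (Ioi x) ≤ 1 := measureReal_le_one
      rw [abs_of_nonpos (by linarith)]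
      simp only [NNReal.coe_one]
      nlinarith
    · have h1 := KK_diff_lower μ h hxy
      have h2 : 0 ≤ μ.real (Ici x) * (x - y) := mul_nonneg measureReal_nonneg (by linarith)
      have := abs_nonneg (x - y)
      simp only [NNReal.coe_one]
      linarith
  exact this.continuous

theorem tend_Ici_right (μ : Measure ℝ) [IsProbabilityMeasure μ] (x : ℝ) :
    Tendsto (fun y => μ.real (Ici y)) (nhdsWithin x (Ioi x)) (nhds (μ.real (Ioi x))) := by
  have anti : Antitone (fun y : ℝ => μ.real (Ici y)) := fun a b hab =>
    measureReal_mono (Ici_subset_Ici.2 hab)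
  refine tendsto_order.2 ⟨fun a ha => ?_, fun a ha => ?_⟩
  · obtain ⟨u, hu, hux, hut⟩ := exists_seq_strictAnti_tendsto x
    have e : Ioi x = ⋃ n, Ici (u n) := by
      ext z; simp only [mem_Ioi, mem_iUnion, mem_Ici]
      constructor
      · intro hz
        obtain ⟨n, hn⟩ := ((tendsto_order.1 hut).2 z hz).exists
        exact ⟨n, hn.le⟩
      · rintro ⟨n, hn⟩; exact (hux n).trans_le hn
    have ht : Tendsto (fun n => μ.real (Ici (u n))) atTop (nhds (μ.real (Ioi x))) := by
      rw [e]
      exact (ENNReal.tendsto_toReal (measure_ne_top _ _)).comp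
        (tendsto_measure_iUnion_atTop fun m n hmn => Ici_subset_Ici.2 (hu.antitone hmn))
    obtain ⟨n, hn⟩ := ((tendsto_order.1 ht).1 a ha).exists
    filter_upwards [Ioo_mem_nhdsGT (hux n)] with y hy
    exact hn.trans_le (anti hy.2.le)
  · filter_upwards [self_mem_nhdsWithin] with y hy
    have hsub : Ici y ⊆ Ioi x := Ici_subset_Ioi.2 hy
    exact (measureReal_mono hsub).trans_lt ha

theorem KK_deriv (μ : Measure ℝ) [IsProbabilityMeasure μ]
    (h : Integrable (fun u : ℝ => u) μ) (x : ℝ) :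
    HasDerivWithinAt (KK μ) (-μ.real (Ioi x)) (Ici x) x := by
  rw [hasDerivWithinAt_iff_tendsto_slope, Set.Ici_sdiff_left]
  refine tendsto_of_tendsto_of_tendsto_of_le_of_le' tendsto_const_nhds (tend_Ici_right μ x).neg
    ?_ ?_
  · filter_upwards [self_mem_nhdsWithin] with y hy
    have hy : x < y := hy
    have := KK_diff_upper μ h hy.le
    rw [slope_def_field, le_div_iff₀ (by linarith)]; linarith
  · filter_upwards [self_mem_nhdsWithin] with y hy
    have hy : x < y := hy
    have := KK_diff_lower μ h hy.le
    rw [slope_def_field, div_le_iff₀ (by linarith)]; linarith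

theorem le_Ici_of_left (μ : Measure ℝ) [IsProbabilityMeasure μ] (x c : ℝ)
    (h : ∀ y < x, c ≤ μ.real (Ioi y)) : c ≤ μ.real (Ici x) := by
  obtain ⟨u, hu, hux, hut⟩ := exists_seq_strictMono_tendsto x
  have e : Ici x = ⋂ n, Ioi (u n) := by
    ext z; simp only [mem_Ioi, mem_iInter, mem_Ici]
    constructor
    · intro hz n; exact (hux n).trans_le hz
    · intro hn; exact le_of_tendsto' hut fun n => (hn n).le
  have ht : Tendsto (fun n => μ.real (Ioi (u n))) atTop (nhds (μ.real (Ici x))) := by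
    rw [e]
    exact (ENNReal.tendsto_toReal (measure_ne_top _ _)).comp
      (tendsto_measure_iInter_atTop (fun n => measurableSet_Ioi.nullMeasurableSet)
        (fun m n hmn => Ioi_subset_Ioi (hu.monotone hmn)) ⟨0, measure_ne_top _ _⟩)
  exact ge_of_tendsto' ht fun n => h _ (hux n)

theorem psi_num (μ : Measure ℝ) [IsProbabilityMeasure μ]
    (h : Integrable (fun u : ℝ => u) μ) (x : ℝ) :
    (∫ y in Ici x, y ∂μ) - meanM μ = KK μ x + x * μ.real (Ici x) := by
  have : (∫ u, max (u - x) 0 ∂μ) = ∫ y in Ici x, (y - x) ∂μ := by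
    rw [← integral_indicator measurableSet_Ici]
    congr 1; ext u
    by_cases hu : u ∈ Ici x
    · rw [indicator_of_mem hu, max_eq_left (sub_nonneg.2 hu)]
    · rw [indicator_of_notMem hu, max_eq_right]
      have : u < x := not_le.1 (fun hh => hu hh)
      linarith
  unfold KK meanM
  rw [this, integral_sub h.integrableOn (integrable_const x).integrableOn, setIntegral_const,
    smul_eq_mul]
  ring

theorem pos_of_lt_rSup (μ : Measure ℝ) [IsProbabilityMeasure μ] {x : ℝ}
    (hx : (x : EReal) < rSupE μ) : 0 < μ.real (Ici x) := by
  refine lt_of_le_of_ne measureReal_nonneg fun h0 => ?_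
  have : μ (Ici x) = 0 := (measureReal_eq_zero_iff).1 h0.symm
  have hle : rSupE μ ≤ (x : EReal) := sInf_le ⟨x, this, rfl⟩
  exact absurd hle (not_le.2 hx)

theorem zero_of_rSup_lt (μ : Measure ℝ) {x : ℝ}
    (hx : rSupE μ < (x : EReal)) : μ.real (Ici x) = 0 := by
  obtain ⟨_, ⟨z, hz, rfl⟩, hzx⟩ := sInf_lt_iff.1 hx
  have hzx : z < x := EReal.coe_lt_coe_iff.1 hzx
  have : μ (Ici x) = 0 := measure_mono_null (Ici_subset_Ici.2 hzx.le) hz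
  simp [Measure.real, this]

theorem psi_eq (μ : Measure ℝ) [IsProbabilityMeasure μ]
    (h : Integrable (fun u : ℝ => u) μ) {x : ℝ} (hx : (x : EReal) < rSupE μ) :
    psiWds μ x = ((x + KK μ x / μ.real (Ici x) : ℝ) : EReal) := by
  have hp := pos_of_lt_rSup μ hx
  unfold psiWds
  rw [if_pos hx, psi_num μ h]
  change (((KK μ x + x * μ.real (Ici x)) / μ.real (Ici x) : ℝ) : EReal) = _
  congr 1
  field_simp
  ring

theorem fwd_ineq (μ ν : Measure ℝ) [IsProbabilityMeasure μ] [IsProbabilityMeasure ν]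
    (hμ : Integrable (fun u : ℝ => u) μ) (hν : Integrable (fun u : ℝ => u) ν)
    (hmμ : (∫ u, u ∂μ) < 0) (hmν : (∫ u, u ∂ν) < 0)
    (hpsi : ∀ x, psiWds μ x ≤ psiWds ν x) (x : ℝ) (hx : (x : EReal) ≠ rSupE ν) :
    ν.real (Ici x) * KK μ x ≤ μ.real (Ici x) * KK ν x := by
  rcases lt_or_gt_of_ne hx with hx | hx
  · have hx2 : (x : EReal) < rSupE μ := by
      by_contra hc
      have h1 := hpsi x
      rw [psi_eq ν hν hx, psiWds, if_neg hc] at h1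
      exact absurd h1 (not_le.2 (EReal.coe_lt_top _))
    have h1 := hpsi x
    rw [psi_eq ν hν hx, psi_eq μ hμ hx2, EReal.coe_le_coe_iff] at h1
    have h2 := le_of_add_le_add_left h1
    rw [div_le_div_iff₀ (pos_of_lt_rSup μ hx2) (pos_of_lt_rSup ν hx)] at h2
    linarith
  · rw [zero_of_rSup_lt ν hx, zero_mul]
    exact mul_nonneg measureReal_nonneg (KK_pos ν hmν x).le

theorem fwd_ineq' (μ ν : Measure ℝ) [IsProbabilityMeasure μ] [IsProbabilityMeasure ν]
    (hμ : Integrable (fun u : ℝ => u) μ) (hν : Integrable (fun u : ℝ => u) ν)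
    (hmμ : (∫ u, u ∂μ) < 0) (hmν : (∫ u, u ∂ν) < 0)
    (hpsi : ∀ x, psiWds μ x ≤ psiWds ν x) (x : ℝ) :
    ν.real (Ioi x) * KK μ x ≤ μ.real (Ioi x) * KK ν x := by
  have hk : ∀ (ρ : Measure ℝ) [IsProbabilityMeasure ρ], Integrable (fun u : ℝ => u) ρ →
      Tendsto (KK ρ) (nhdsWithin x (Ioi x)) (nhds (KK ρ x)) := fun ρ _ hρ =>
    ((KK_cont ρ hρ).tendsto x).mono_left nhdsWithin_le_nhds
  refine le_of_tendsto_of_tendsto ((tend_Ici_right ν x).mul (hk μ hμ))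
    ((tend_Ici_right μ x).mul (hk ν hν)) ?_
  have key : ∀ᶠ y in nhdsWithin x (Ioi x), ((y : ℝ) : EReal) ≠ rSupE ν := by
    by_cases hc : (x : EReal) < rSupE ν
    · have : ∀ᶠ y : ℝ in nhds x, (y : EReal) < rSupE ν :=
        (continuous_coe_real_ereal.tendsto x).eventually_lt_const hc
      filter_upwards [this.filter_mono nhdsWithin_le_nhds] with y hy using hy.ne
    · filter_upwards [self_mem_nhdsWithin] with y hy
      exact ((not_lt.1 hc).trans_lt (EReal.coe_lt_coe_iff.2 hy)).ne'
  filter_upwards [key] with y hy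
  exact fwd_ineq μ ν hμ hν hmμ hmν hpsi y hy

theorem fwd (μ ν : Measure ℝ) [IsProbabilityMeasure μ] [IsProbabilityMeasure ν]
    (hμ : Integrable (fun u : ℝ => u) μ) (hν : Integrable (fun u : ℝ => u) ν)
    (hmμ : (∫ u, u ∂μ) < 0) (hmν : (∫ u, u ∂ν) < 0)
    (hpsi : ∀ x, psiWds μ x ≤ psiWds ν x) {a b : ℝ} (hab : a ≤ b) :
    KK ν a * KK μ b ≤ KK μ a * KK ν b := by
  have hpos := KK_pos ν hmν
  have := image_le_of_deriv_right_le_deriv_boundary (f := fun x => KK μ x / KK ν x)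
    (f' := fun x => ((-μ.real (Ioi x)) * KK ν x - KK μ x * (-ν.real (Ioi x))) / KK ν x ^ 2)
    (a := a) (b := b) (B := fun _ => KK μ a / KK ν a) (B' := fun _ => 0)
    ((KK_cont μ hμ).div (KK_cont ν hν) fun x => (hpos x).ne').continuousOn
    (fun x _ => (KK_deriv μ hμ x).div (KK_deriv ν hν x) (hpos x).ne') le_rfl
    continuousOn_const (fun x _ => hasDerivWithinAt_const _ _ _)
    (fun x _ => by
      apply div_nonpos_of_nonpos_of_nonneg _ (sq_nonneg _)
      have := fwd_ineq' μ ν hμ hν hmμ hmν hpsi x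
      linarith) (right_mem_Icc.2 hab)
  rw [div_le_div_iff₀ (hpos b) (hpos a)] at this
  linarith

theorem bwd (μ ν : Measure ℝ) [IsProbabilityMeasure μ] [IsProbabilityMeasure ν]
    (hμ : Integrable (fun u : ℝ => u) μ) (hν : Integrable (fun u : ℝ => u) ν)
    (hmμ : (∫ u, u ∂μ) < 0) (hmν : (∫ u, u ∂ν) < 0)
    (H : ∀ a b, a ≤ b → KK ν a * KK μ b ≤ KK μ a * KK ν b) (x : ℝ) :
    psiWds μ x ≤ psiWds ν x := by
  by_cases hx : (x : EReal) < rSupE ν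
  swap
  · conv_rhs => rw [psiWds, if_neg hx]
    exact le_top
  have key : ∀ y, ν.real (Ici y) * KK μ y ≤ μ.real (Ici y) * KK ν y := by
    intro y
    rw [← div_le_iff₀ (KK_pos ν hmν y)]
    refine le_Ici_of_left μ y _ fun z hz => ?_
    rw [div_le_iff₀ (KK_pos ν hmν y)]
    have h1 := H z y hz.le
    have h2 := mul_le_mul_of_nonneg_right (KK_diff_lower ν hν hz.le) (KK_pos μ hmμ y).le
    have h3 := mul_le_mul_of_nonneg_right (KK_diff_upper μ hμ hz.le) (KK_pos ν hmν y).le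
    refine le_of_mul_le_mul_right (a := y - z) ?_ (by linarith)
    linarith
  have hx2 : (x : EReal) < rSupE μ := by
    obtain ⟨q, hxq, hq⟩ := EReal.lt_iff_exists_real_btwn.1 hx
    refine hxq.trans_le ?_
    by_contra hc
    have h0 := zero_of_rSup_lt μ (not_le.1 hc)
    have h1 := key q
    rw [h0, zero_mul] at h1
    exact absurd h1 (not_le.2 (mul_pos (pos_of_lt_rSup ν hq) (KK_pos μ hmμ q)))
  rw [psi_eq ν hν hx, psi_eq μ hμ hx2, EReal.coe_le_coe_iff]
  refine add_le_add le_rfl ?_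
  rw [div_le_div_iff₀ (pos_of_lt_rSup μ hx2) (pos_of_lt_rSup ν hx)]
  linarith [key x]

theorem lc (f : ℝ → ℝ) (hf0 : ∀ y, 0 ≤ f y)
    (hf : ∀ x y t : ℝ, 0 ≤ t → t ≤ 1 → f x ^ t * f y ^ (1 - t) ≤ f (t * x + (1 - t) * y))
    {p q p' q' : ℝ} (h1 : p ≤ p') (h2 : p' ≤ q) (h3 : p + q = p' + q') :
    f p * f q ≤ f p' * f q' := by
  rcases eq_or_lt_of_le (h1.trans h2) with h | h
  · have e1 : p' = p := by linarith
    have e2 : q' = q := by linarith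
    rw [e1, e2]
  have hd : 0 < q - p := by linarith
  set l := (q - p') / (q - p) with hl
  have hl0 : 0 ≤ l := div_nonneg (by linarith) hd.le
  have hl1 : l ≤ 1 := (div_le_one hd).2 (by linarith)
  have hm : l * (q - p) = q - p' := div_mul_cancel₀ _ hd.ne'
  have a1 := hf p q l hl0 hl1
  have a2 := hf p q (1 - l) (by linarith) (by linarith)
  rw [show l * p + (1 - l) * q = p' by linarith] at a1
  rw [show (1 - l) * p + (1 - (1 - l)) * q = q' by linarith] at a2
  have a3 := mul_le_mul a1 a2 (by have := hf0 p; have := hf0 q; positivity) (hf0 _)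
  refine le_trans (le_of_eq ?_) a3
  have e1 : f p = f p ^ l * f p ^ (1 - l) := by
    rw [← Real.rpow_add_of_nonneg (hf0 p) hl0 (by linarith)]; simp
  have e2 : f q = f q ^ (1 - l) * f q ^ (1 - (1 - l)) := by
    rw [← Real.rpow_add_of_nonneg (hf0 q) (by linarith) (by linarith)]; simp
  calc f p * f q = (f p ^ l * f p ^ (1 - l)) * (f q ^ (1 - l) * f q ^ (1 - (1 - l))) := by
        rw [← e1, ← e2]
    _ = _ := by ring

/-- Cauchy-Binet step -/
theorem cb (f g h : ℝ → ℝ) {a b : ℝ} (hab : a ≤ b)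
    (hf0 : ∀ y, 0 ≤ f y)
    (hf : ∀ x y t : ℝ, 0 ≤ t → t ≤ 1 → f x ^ t * f y ^ (1 - t) ≤ f (t * x + (1 - t) * y))
    (ig : ∀ x, Integrable fun z => g z * f (x - z)) (ih : ∀ x, Integrable fun z => h z * f (x - z))
    (H : ∀ a b, a ≤ b → h a * g b ≤ g a * h b) :
    (∫ z, h z * f (a - z)) * (∫ z, g z * f (b - z)) ≤
      (∫ z, g z * f (a - z)) * (∫ z, h z * f (b - z)) := by
  have i1 := (ih a).mul_prod (ig b)
  have i1' := (ig b).mul_prod (ih a)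
  have i2 := (ig a).mul_prod (ih b)
  have i2' := (ih b).mul_prod (ig a)
  have e1 := integral_prod_mul (μ := volume) (ν := volume) (fun z => h z * f (a - z))
    (fun z => g z * f (b - z))
  have e1' := integral_prod_mul (μ := volume) (ν := volume) (fun z => g z * f (b - z))
    (fun z => h z * f (a - z))
  have e2 := integral_prod_mul (μ := volume) (ν := volume) (fun z => g z * f (a - z))
    (fun z => h z * f (b - z))
  have e2' := integral_prod_mul (μ := volume) (ν := volume) (fun z => h z * f (b - z))
    (fun z => g z * f (a - z))
  have m := integral_mono (i1.add i1') (i2.add i2') (fun p => by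
    obtain ⟨z, w⟩ := p
    simp only [Pi.add_apply]
    have main : ∀ z w, z ≤ w → 0 ≤ (g z * h w - g w * h z) *
        (f (a - z) * f (b - w) - f (b - z) * f (a - w)) := by
      intro z w hzw
      refine mul_nonneg ?_ ?_
      · have := H z w hzw; linarith
      · have := lc f hf0 hf (p := a - w) (q := b - z) (p' := a - z) (q' := b - w)
          (by linarith) (by linarith) (by ring)
        linarith
    rcases le_total z w with hzw | hzw
    · have := main z w hzw; linarith
    · have := main w z hzw; linarith)
  rw [integral_add' i1 i1', integral_add' i2 i2', e1, e1', e2, e2'] at m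
  linarith

theorem KK_conv {Ω : Type*} [MeasureSpace Ω] [IsProbabilityMeasure (volume : Measure Ω)]
    (X : Ω → ℝ) (Y : Ω → ℝ) (f : ℝ → ℝ)
    (hX : Measurable X) (hY : Measurable Y) (hXint : Integrable X)
    (hYint : Integrable Y) (hYcent : (∫ ω, Y ω) = 0)
    (hindep : ProbabilityTheory.IndepFun X Y)
    (hf0 : ∀ y, 0 ≤ f y) (hfmeas : Measurable f)
    (hfdens : Measure.map Y volume = volume.withDensity fun y => ENNReal.ofReal (f y)) (x : ℝ) :
    Integrable (fun z => KK (Measure.map X volume) z * f (x - z)) ∧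
    KK (Measure.map (fun ω => X ω + Y ω) volume) x =
      ∫ z, KK (Measure.map X volume) z * f (x - z) := by
  set μ := Measure.map X volume with hμ
  set ν := Measure.map Y volume with hν
  have : IsProbabilityMeasure μ := Measure.isProbabilityMeasure_map hX.aemeasurable
  have : IsProbabilityMeasure ν := Measure.isProbabilityMeasure_map hY.aemeasurable
  have hp : Measure.map (fun ω => (X ω, Y ω)) volume = μ.prod ν :=
    (ProbabilityTheory.indepFun_iff_map_prod_eq_prod_map_map hX.aemeasurable
      hY.aemeasurable).1 hindep
  have hXY : Measurable fun ω => (X ω, Y ω) := hX.prodMk hY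
  have iF : Integrable (fun p : ℝ × ℝ => max (p.1 + p.2 - x) 0) (μ.prod ν) := by
    rw [← hp, integrable_map_measure (by fun_prop) hXY.aemeasurable]
    exact ((hXint.add hYint).sub (integrable_const x)).pos_part
  have eF : (∫ ω, max (X ω + Y ω - x) 0) = ∫ y, ∫ u, max (u + y - x) 0 ∂μ ∂ν := by
    rw [← integral_prod_symm _ iF, ← hp, integral_map hXY.aemeasurable (by fun_prop)]
  have e0 : KK (Measure.map (fun ω => X ω + Y ω) volume) x =
      (∫ ω, max (X ω + Y ω - x) 0) - ∫ ω, X ω := by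
    have hS : AEMeasurable (fun ω => X ω + Y ω) (volume : Measure Ω) := (hX.add hY).aemeasurable
    unfold KK
    rw [integral_map hS (by fun_prop), integral_map hS (by fun_prop), integral_add hXint hYint, hYcent,
      add_zero]
  have eK : ∀ y, KK μ (x - y) = (∫ u, max (u + y - x) 0 ∂μ) - ∫ ω, X ω := by
    intro y
    unfold KK
    rw [integral_map (f := fun u : ℝ => u) hX.aemeasurable (by fun_prop)]
    congr 2; ext u; congr 1; ring
  have iK0 := iF.integral_prod_right
  have iK : Integrable (fun y => KK μ (x - y)) ν := by
    simp_rw [eK]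
    exact iK0.sub (integrable_const _)
  have e1 : KK (Measure.map (fun ω => X ω + Y ω) volume) x = ∫ y, KK μ (x - y) ∂ν := by
    simp_rw [eK]
    rw [integral_sub iK0 (integrable_const _), e0, eF]; simp
  have hae : ∀ᵐ y : ℝ, ENNReal.ofReal (f y) < ⊤ := ae_of_all _ fun _ => ENNReal.ofReal_lt_top
  have iV : Integrable (fun y => KK μ (x - y) * f y) := by
    rw [hfdens, integrable_withDensity_iff (by fun_prop) hae] at iK
    simpa only [ENNReal.toReal_ofReal (hf0 _)] using iK
  have e2 : ∫ y, KK μ (x - y) ∂ν = ∫ y, KK μ (x - y) * f y := by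
    rw [hfdens, integral_withDensity_eq_integral_toReal_smul (by fun_prop) hae]
    simp only [ENNReal.toReal_ofReal (hf0 _), smul_eq_mul, mul_comm]
  constructor
  · have := iV.comp_sub_left x
    simpa using this
  · rw [e1, e2, ← integral_sub_left_eq_self _ volume x]
    simp

theorem stmt12 {Ω : Type*} [MeasureSpace Ω] [IsProbabilityMeasure (volume : Measure Ω)]
    (X : ℝ → Ω → ℝ) (Y : Ω → ℝ) (f : ℝ → ℝ)
    (hXmeas : ∀ t, Measurable (X t)) (hYmeas : Measurable Y)
    (hXint : ∀ t, 0 ≤ t → Integrable (X t))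
    (hXneg : ∀ t, 0 ≤ t → (∫ ω, X t ω) < 0)
    (hYint : Integrable Y) (hYcent : (∫ ω, Y ω) = 0)
    (hindep : ∀ t, 0 ≤ t → ProbabilityTheory.IndepFun (X t) Y)
    (hf0 : ∀ y, 0 ≤ f y) (hfmeas : Measurable f)
    (hfdens : ∀ s : Set ℝ, MeasurableSet s →
      Measure.map Y volume s = ENNReal.ofReal (∫ y in s, f y))
    (hflogconc : ∀ x y t : ℝ, 0 ≤ t → t ≤ 1 →
      f x ^ t * f y ^ (1 - t) ≤ f (t * x + (1 - t) * y))
    (hwds : ∀ s t, 0 ≤ s → s ≤ t → ∀ x : ℝ,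
      psiWds (Measure.map (X s) volume) x ≤ psiWds (Measure.map (X t) volume) x) :
    ∀ s t, 0 ≤ s → s ≤ t → ∀ x : ℝ,
      psiWds (Measure.map (fun ω => X s ω + Y ω) volume) x ≤
        psiWds (Measure.map (fun ω => X t ω + Y ω) volume) x := by
  intro s t hs hst x
  have ht := hs.trans hst
  have : IsProbabilityMeasure (Measure.map Y volume) :=
    Measure.isProbabilityMeasure_map hYmeas.aemeasurable
  have fint : Integrable f := by
    by_contra hc
    have := hfdens univ MeasurableSet.univ
    rw [setIntegral_univ, integral_undef hc] at this
    simp at this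
  have hd : Measure.map Y volume = volume.withDensity fun y => ENNReal.ofReal (f y) := by
    ext A hA
    rw [hfdens A hA, withDensity_apply _ hA,
      ofReal_integral_eq_lintegral_ofReal fint.integrableOn (ae_of_all _ hf0)]
  have prob : ∀ Z : Ω → ℝ, Measurable Z → IsProbabilityMeasure (Measure.map Z volume) :=
    fun Z hZ => Measure.isProbabilityMeasure_map hZ.aemeasurable
  have int : ∀ Z : Ω → ℝ, Measurable Z → Integrable Z →
      Integrable (fun u : ℝ => u) (Measure.map Z volume) := fun Z hZ hi =>
    (integrable_map_measure (by fun_prop) hZ.aemeasurable).2 hi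
  have mean : ∀ Z : Ω → ℝ, Measurable Z → (∫ u, u ∂(Measure.map Z volume)) = ∫ ω, Z ω :=
    fun Z hZ => integral_map hZ.aemeasurable (by fun_prop)
  have mneg : ∀ r, 0 ≤ r → (∫ u, u ∂(Measure.map (X r) volume)) < 0 := fun r hr => by
    rw [mean _ (hXmeas r)]; exact hXneg r hr
  have msum : ∀ r, Measurable fun ω => X r ω + Y ω := fun r => (hXmeas r).add hYmeas
  have mneg' : ∀ r, 0 ≤ r → (∫ u, u ∂(Measure.map (fun ω => X r ω + Y ω) volume)) < 0 :=
    fun r hr => by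
      rw [mean _ (msum r), integral_add (hXint r hr) hYint, hYcent, add_zero]
      exact hXneg r hr
  have conv := fun r (hr : 0 ≤ r) z => KK_conv (X r) Y f (hXmeas r) hYmeas (hXint r hr) hYint
    hYcent (hindep r hr) hf0 hfmeas hd z
  have := prob _ (hXmeas s)
  have := prob _ (hXmeas t)
  have := prob _ (msum s)
  have := prob _ (msum t)
  refine bwd _ _ (int _ (msum s) ((hXint s hs).add hYint)) (int _ (msum t) ((hXint t ht).add hYint))
    (mneg' s hs) (mneg' t ht) (fun a b hab => ?_) x
  rw [(conv s hs a).2, (conv s hs b).2, (conv t ht a).2, (conv t ht b).2]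
  exact cb f _ _ hab hf0 hflogconc (fun z => (conv s hs z).1) (fun z => (conv t ht z).1)
    fun a b hab => fwd _ _ (int _ (hXmeas s) (hXint s hs)) (int _ (hXmeas t) (hXint t ht))
      (mneg s hs) (mneg t ht) (hwds s t hs hst) hab
end
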